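/- arXiv:1504.05309 — 5 statements merged into one kernel-verified Lean document; each statement's English description precedes it below -/
import Mathlib

section
/- Let s, K, σ, τ > 0 and r ∈ ℝ. Define d₁ = (log(s/K) + (r + σ²/2)τ)/(σ√τ) and d₂ = d₁ − σ√τ. Then the discounted Gaussian expectation of the call payoff under the risk-neutral lognormal distribution satisfies e^{−rτ} · (2π)^{−1/2} ∫_ℝ max(s·exp((r − σ²/2)τ + σ√τ·z) − K, 0) · e^{−z²/2} dz = s·Φ(d₁) − K·e^{−rτ}·Φ(d₂) (the Black–Scholes call option formula). -/
open Real MeasureTheory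

/-- The standard normal cumulative distribution function. -/
noncomputable def Phi (x : ℝ) : ℝ :=
  (Real.sqrt (2 * Real.pi))⁻¹ * ∫ y in Set.Iio x, Real.exp (-(y ^ 2) / 2)

/-- `Phi d` as the full-line integral of a reflected, translated truncation of the Gaussian. -/
lemma integral_indicator_Iio_comp_sub (c d : ℝ) :
    ∫ z : ℝ, (Set.Iio d).indicator (fun y : ℝ => Real.exp (-(y ^ 2) / 2)) (c - z) =
      ∫ y in Set.Iio d, Real.exp (-(y ^ 2) / 2) := by
  rw [integral_sub_left_eq_self ((Set.Iio d).indicator fun y : ℝ => Real.exp (-(y ^ 2) / 2)),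
    integral_indicator measurableSet_Iio]

lemma integrable_indicator_Iio_comp_sub (c d : ℝ) :
    Integrable fun z : ℝ =>
      (Set.Iio d).indicator (fun y : ℝ => Real.exp (-(y ^ 2) / 2)) (c - z) := by
  have h : Integrable fun y : ℝ => Real.exp (-(y ^ 2) / 2) := by
    convert integrable_exp_neg_mul_sq (b := 1 / 2) (by norm_num) using 3
    ring
  exact (h.indicator measurableSet_Iio).comp_sub_left c

/-- The Black–Scholes call option formula: the discounted Gaussian expectation of the
call payoff under the risk-neutral lognormal distribution equals `s·Φ(d₁) − K·e^{−rτ}·Φ(d₂)`. -/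
theorem black_scholes_call_formula
    (s K σ τ r : ℝ) (hs : 0 < s) (hK : 0 < K) (hσ : 0 < σ) (hτ : 0 < τ)
    (d₁ d₂ : ℝ)
    (hd₁ : d₁ = (Real.log (s / K) + (r + σ ^ 2 / 2) * τ) / (σ * Real.sqrt τ))
    (hd₂ : d₂ = d₁ - σ * Real.sqrt τ) :
    Real.exp (-r * τ) * (Real.sqrt (2 * Real.pi))⁻¹ *
        (∫ z : ℝ, max (s * Real.exp ((r - σ ^ 2 / 2) * τ + σ * Real.sqrt τ * z) - K) 0 *
          Real.exp (-(z ^ 2) / 2))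
      = s * Phi d₁ - K * Real.exp (-r * τ) * Phi d₂ := by
  set c := σ * √τ with hc
  have hcpos : 0 < c := by positivity
  have hcsq : c ^ 2 = σ ^ 2 * τ := by rw [hc, mul_pow, Real.sq_sqrt hτ.le]
  have hcd : c * d₁ = Real.log (s / K) + (r + σ ^ 2 / 2) * τ := by
    rw [hd₁]
    field_simp
  have hprice (z : ℝ) :
      s * Real.exp ((r - σ ^ 2 / 2) * τ + c * z) = K * Real.exp (c * (z + d₂)) := by
    have hlog : c * (z + d₂) = Real.log (s / K) + ((r - σ ^ 2 / 2) * τ + c * z) := by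
      rw [hd₂]
      linear_combination hcd - hcsq
    rw [hlog, Real.exp_add (Real.log _), Real.exp_log (by positivity)]
    field_simp
  have hshift (z : ℝ) :
      Real.exp ((r - σ ^ 2 / 2) * τ + c * z) * Real.exp (-(z ^ 2) / 2) =
        Real.exp (r * τ) * Real.exp (-((c - z) ^ 2) / 2) := by
    rw [← Real.exp_add, ← Real.exp_add]
    congr 1
    linear_combination (1 / 2) * hcsq
  have hpayoff (z : ℝ) :
      max (s * Real.exp ((r - σ ^ 2 / 2) * τ + c * z) - K) 0 * Real.exp (-(z ^ 2) / 2) =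
        s * Real.exp (r * τ) *
            (Set.Iio d₁).indicator (fun y : ℝ => Real.exp (-(y ^ 2) / 2)) (c - z) -
          K * (Set.Iio d₂).indicator (fun y : ℝ => Real.exp (-(y ^ 2) / 2)) (0 - z) := by
    rcases lt_or_ge 0 (z + d₂) with hz | hz
    · have hexp : 1 ≤ Real.exp (c * (z + d₂)) := Real.one_le_exp (by positivity)
      have hge : 0 ≤ s * Real.exp ((r - σ ^ 2 / 2) * τ + c * z) - K := by
        rw [hprice]
        nlinarith
      rw [max_eq_left hge,
        Set.indicator_of_mem (show c - z ∈ Set.Iio d₁ by rw [Set.mem_Iio]; linarith),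
        Set.indicator_of_mem (show 0 - z ∈ Set.Iio d₂ by rw [Set.mem_Iio]; linarith),
        show (0 - z) ^ 2 = z ^ 2 by ring]
      linear_combination s * hshift z
    · have hexp : Real.exp (c * (z + d₂)) ≤ 1 :=
        Real.exp_le_one_iff.mpr (mul_nonpos_of_nonneg_of_nonpos hcpos.le hz)
      have hle : s * Real.exp ((r - σ ^ 2 / 2) * τ + c * z) - K ≤ 0 := by
        rw [hprice]
        nlinarith
      rw [max_eq_right hle,
        Set.indicator_of_notMem (show c - z ∉ Set.Iio d₁ by rw [Set.mem_Iio]; linarith),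
        Set.indicator_of_notMem (show 0 - z ∉ Set.Iio d₂ by rw [Set.mem_Iio]; linarith)]
      ring
  have hdisc : Real.exp (-r * τ) * Real.exp (r * τ) = 1 := by
    rw [← Real.exp_add, neg_mul, neg_add_cancel, Real.exp_zero]
  simp_rw [hpayoff]
  rw [integral_sub ((integrable_indicator_Iio_comp_sub c d₁).const_mul _)
      ((integrable_indicator_Iio_comp_sub 0 d₂).const_mul _),
    integral_const_mul, integral_const_mul, integral_indicator_Iio_comp_sub,
    integral_indicator_Iio_comp_sub, Phi, Phi]
  linear_combination
    s * (√(2 * Real.pi))⁻¹ * (∫ y in Set.Iio d₁, Real.exp (-(y ^ 2) / 2)) * hdisc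
end

section
/- Let s, K, σ, τ > 0 and r ∈ ℝ. Define d₁ = (log(s/K) + (r + σ²/2)τ)/(σ√τ) and d₂ = d₁ − σ√τ. Then e^{−rτ} · (2π)^{−1/2} ∫_ℝ max(K − s·exp((r − σ²/2)τ + σ√τ·z), 0) · e^{−z²/2} dz = K·e^{−rτ}·Φ(−d₂) − s·Φ(−d₁) (the Black–Scholes put option formula). -/
open Real MeasureTheory

theorem integrable_exp_neg_sq_div_two :
    Integrable fun z : ℝ => Real.exp (-(z ^ 2) / 2) := by
  refine (integrable_exp_neg_mul_sq (b := 1 / 2) (by norm_num)).congr (.of_forall fun z => ?_)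
  change Real.exp _ = Real.exp _
  ring_nf

/-- Translating the variable of a Gaussian integral over a left half-line. -/
theorem setIntegral_Iio_exp_neg_sub_sq_div_two (a b : ℝ) :
    ∫ z in Set.Iio b, Real.exp (-((z - a) ^ 2) / 2) =
      ∫ z in Set.Iio (b - a), Real.exp (-(z ^ 2) / 2) := by
  rw [← integral_indicator measurableSet_Iio, ← integral_indicator measurableSet_Iio,
    ← integral_add_right_eq_self _ a]
  congr 1 with z
  simp [Set.indicator_apply, lt_sub_iff_add_lt]

/-- A put payoff with exercise boundary `-d`, integrated against the unnormalized
standard Gaussian density. -/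
theorem integral_max_sub_mul_exp_neg_sq_div_two {K a : ℝ} (hK : 0 < K) (ha : 0 < a) (d : ℝ) :
    ∫ z : ℝ, max (K - K * Real.exp (a * (d + z))) 0 * Real.exp (-(z ^ 2) / 2) =
      K * (∫ z in Set.Iio (-d), Real.exp (-(z ^ 2) / 2)) -
        K * Real.exp (a * d + a ^ 2 / 2) *
          ∫ z in Set.Iio (-d - a), Real.exp (-(z ^ 2) / 2) := by
  have key : (fun z : ℝ => max (K - K * Real.exp (a * (d + z))) 0 * Real.exp (-(z ^ 2) / 2)) =
      (Set.Iio (-d)).indicator fun z => K * Real.exp (-(z ^ 2) / 2) -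
        K * Real.exp (a * d + a ^ 2 / 2) * Real.exp (-((z - a) ^ 2) / 2) := by
    ext z
    by_cases hz : z < -d
    · have h : Real.exp (a * (d + z)) ≤ 1 := Real.exp_le_one_iff.2 (by nlinarith)
      rw [Set.indicator_of_mem (Set.mem_Iio.2 hz), max_eq_left (by nlinarith), sub_mul,
        mul_assoc, mul_assoc, ← Real.exp_add, ← Real.exp_add]
      ring_nf
    · have h : 1 ≤ Real.exp (a * (d + z)) := Real.one_le_exp (mul_nonneg ha.le (by linarith))
      rw [Set.indicator_of_notMem (by simpa using hz), max_eq_right (by nlinarith), zero_mul]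
  rw [key, integral_indicator measurableSet_Iio, integral_sub, integral_const_mul,
    integral_const_mul, setIntegral_Iio_exp_neg_sub_sq_div_two]
  · exact (integrable_exp_neg_sq_div_two.const_mul _).integrableOn
  · exact ((integrable_exp_neg_sq_div_two.comp_sub_right a).const_mul _).integrableOn

/-- The Black–Scholes put option formula: the discounted Gaussian expectation of the
put payoff under the risk-neutral lognormal distribution equals
`K·e^{−rτ}·Φ(−d₂) − s·Φ(−d₁)`. -/
theorem black_scholes_put_formula
    (s K σ τ r : ℝ) (hs : 0 < s) (hK : 0 < K) (hσ : 0 < σ) (hτ : 0 < τ)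
    (d₁ d₂ : ℝ)
    (hd₁ : d₁ = (Real.log (s / K) + (r + σ ^ 2 / 2) * τ) / (σ * Real.sqrt τ))
    (hd₂ : d₂ = d₁ - σ * Real.sqrt τ) :
    Real.exp (-r * τ) * (Real.sqrt (2 * Real.pi))⁻¹ *
        (∫ z : ℝ, max (K - s * Real.exp ((r - σ ^ 2 / 2) * τ + σ * Real.sqrt τ * z)) 0 *
          Real.exp (-(z ^ 2) / 2))
      = K * Real.exp (-r * τ) * Phi (-d₂) - s * Phi (-d₁) := by
  have ha : 0 < σ * Real.sqrt τ := mul_pos hσ (Real.sqrt_pos.2 hτ)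
  have ha2 : (σ * Real.sqrt τ) ^ 2 = σ ^ 2 * τ := by rw [mul_pow, Real.sq_sqrt hτ.le]
  have had : σ * Real.sqrt τ * d₂ = Real.log (s / K) + (r - σ ^ 2 / 2) * τ := by
    rw [hd₂, mul_sub, ← sq, ha2, hd₁, mul_div_cancel₀ _ ha.ne']
    ring
  have hd : -d₂ - σ * Real.sqrt τ = -d₁ := by rw [hd₂]; ring
  have hexp (x : ℝ) : K * Real.exp (Real.log (s / K) + x) = s * Real.exp x := by
    rw [Real.exp_add, Real.exp_log (div_pos hs hK)]
    field_simp
  have hprice (z : ℝ) : s * Real.exp ((r - σ ^ 2 / 2) * τ + σ * Real.sqrt τ * z) =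
      K * Real.exp (σ * Real.sqrt τ * (d₂ + z)) := by
    rw [mul_add, had, add_assoc, hexp]
  have hforward : K * Real.exp (σ * Real.sqrt τ * d₂ + (σ * Real.sqrt τ) ^ 2 / 2) =
      s * Real.exp (r * τ) := by
    rw [had, ha2, add_assoc, hexp]
    ring_nf
  have hdisc : Real.exp (-r * τ) * Real.exp (r * τ) = 1 := by
    rw [← Real.exp_add]
    simp
  simp_rw [hprice]
  rw [integral_max_sub_mul_exp_neg_sq_div_two hK ha, hforward, hd, Phi, Phi]
  linear_combination (-s * (Real.sqrt (2 * Real.pi))⁻¹ *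
    ∫ z in Set.Iio (-d₁), Real.exp (-(z ^ 2) / 2)) * hdisc
end

section
/- Fix ω > 0 and k ∈ ℝ, and define the dimensionless Black–Scholes call price C(ω, k) = Φ(d₁) − e^k·Φ(d₂) with d₁ = −k/√ω + √ω/2 and d₂ = −k/√ω − √ω/2. Then the following three partial-derivative identities hold for all ω > 0, k ∈ ℝ: (i) ∂²C/∂ω² = (−1/8 − 1/(2ω) + k²/(2ω²)) · ∂C/∂ω; (ii) ∂²C/∂ω∂k = (1/2 − k/ω) · ∂C/∂ω; (iii) ∂²C/∂k² − ∂C/∂k = 2 · ∂C/∂ω. -/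
open Real MeasureTheory

/-- The dimensionless Black–Scholes call price: initial asset price 1, time to maturity 1,
interest rate 0, strike `e^k` and total variance `ω`. -/
noncomputable def Cdim (ω k : ℝ) : ℝ :=
  Phi (-k / Real.sqrt ω + Real.sqrt ω / 2) -
    Real.exp k * Phi (-k / Real.sqrt ω - Real.sqrt ω / 2)

/-- The standard normal density. -/
noncomputable def stdNormalDensity (x : ℝ) : ℝ :=
  (√(2 * π))⁻¹ * exp (-(x ^ 2) / 2)

theorem hasDerivAt_Phi (x : ℝ) : HasDerivAt Phi (stdNormalDensity x) x := by
  have hexp : Integrable fun y : ℝ => exp (-(y ^ 2) / 2) := by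
    convert integrable_exp_neg_mul_sq (b := 1 / 2) (by norm_num) using 3
    ring
  have hcont : Continuous fun y : ℝ => exp (-(y ^ 2) / 2) := by fun_prop
  have hPhi : Phi = fun x => (√(2 * π))⁻¹ *
      ((∫ y in Set.Iic 0, exp (-(y ^ 2) / 2)) + ∫ y in (0 : ℝ)..x, exp (-(y ^ 2) / 2)) := by
    funext x
    rw [← intervalIntegral.integral_Iic_sub_Iic hexp.integrableOn hexp.integrableOn, Phi,
      ← integral_Iic_eq_integral_Iio]
    ring
  rw [hPhi]
  exact ((hcont.integral_hasStrictDerivAt 0 x).hasDerivAt.const_add _).const_mul _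

theorem hasDerivAt_stdNormalDensity (x : ℝ) :
    HasDerivAt stdNormalDensity (-x * stdNormalDensity x) x := by
  have h := ((((hasDerivAt_id x).fun_pow 2).fun_neg.div_const 2).exp.const_mul (√(2 * π))⁻¹)
  refine h.congr_deriv ?_
  simp only [id, stdNormalDensity]
  ring

theorem exp_mul_stdNormalDensity (k : ℝ) {s : ℝ} (hs : s ≠ 0) :
    exp k * stdNormalDensity (-k / s - s / 2) = stdNormalDensity (-k / s + s / 2) := by
  unfold stdNormalDensity
  rw [mul_left_comm, ← exp_add]
  congr 2
  field_simp
  ring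

theorem hasDerivAt_Cdim_variance (k : ℝ) {w : ℝ} (hw : 0 < w) :
    HasDerivAt (fun w' => Cdim w' k) (stdNormalDensity (-k / √w + √w / 2) / (2 * √w)) w := by
  have hs : √w ≠ 0 := (sqrt_pos.2 hw).ne'
  have hsqrt := hasDerivAt_sqrt hw.ne'
  have hquot := (hasDerivAt_const w (-k)).fun_div hsqrt hs
  have h₁ := (hasDerivAt_Phi _).comp w (hquot.fun_add (hsqrt.div_const 2))
  have h₂ := (hasDerivAt_Phi _).comp w (hquot.fun_sub (hsqrt.div_const 2))
  refine (h₁.fun_sub (h₂.const_mul (exp k))).congr_deriv ?_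
  rw [← mul_assoc, exp_mul_stdNormalDensity k hs]
  field_simp
  ring

theorem hasDerivAt_Cdim_logMoneyness {w : ℝ} (hw : 0 < w) (k : ℝ) :
    HasDerivAt (fun k' => Cdim w k') (-(exp k * Phi (-k / √w - √w / 2))) k := by
  have hs : √w ≠ 0 := (sqrt_pos.2 hw).ne'
  have hquot := (hasDerivAt_id k).fun_neg.div_const √w
  have h₁ := (hasDerivAt_Phi _).comp k (hquot.add_const (√w / 2))
  have h₂ := (hasDerivAt_Phi _).comp k (hquot.sub_const (√w / 2))
  refine (h₁.fun_sub ((hasDerivAt_exp k).fun_mul h₂)).congr_deriv ?_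
  simp only [id, Function.comp]
  rw [← mul_assoc, exp_mul_stdNormalDensity k hs]
  ring

/-- The three partial-derivative identities for the dimensionless Black–Scholes call price:
`C_ωω = (−1/8 − 1/(2ω) + k²/(2ω²))·C_ω`, `C_ωk = (1/2 − k/ω)·C_ω` and
`C_kk − C_k = 2·C_ω`. -/
theorem bs_dimensionless_derivative_identities (ω k : ℝ) (hω : 0 < ω) :
    (deriv (fun w => deriv (fun w' => Cdim w' k) w) ω
        = (-1 / 8 - 1 / (2 * ω) + k ^ 2 / (2 * ω ^ 2)) * deriv (fun w' => Cdim w' k) ω) ∧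
    (deriv (fun k' => deriv (fun w' => Cdim w' k') ω) k
        = (1 / 2 - k / ω) * deriv (fun w' => Cdim w' k) ω) ∧
    (deriv (fun k' => deriv (fun k'' => Cdim ω k'') k') k - deriv (fun k' => Cdim ω k') k
        = 2 * deriv (fun w' => Cdim w' k) ω) := by
  have hs : √ω ≠ 0 := (sqrt_pos.2 hω).ne'
  have hsq : √ω ^ 2 = ω := sq_sqrt hω.le
  have hCω := (hasDerivAt_Cdim_variance k hω).deriv
  refine ⟨?_, ?_, ?_⟩
  · have heq : (fun w => deriv (fun w' => Cdim w' k) w) =ᶠ[nhds ω]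
        fun w => stdNormalDensity (-k / √w + √w / 2) / (2 * √w) := by
      filter_upwards [lt_mem_nhds hω] with w hw
      exact (hasDerivAt_Cdim_variance k hw).deriv
    have hsqrt := hasDerivAt_sqrt hω.ne'
    have hd := ((hasDerivAt_const ω (-k)).fun_div hsqrt hs).fun_add (hsqrt.div_const 2)
    have h := ((hasDerivAt_stdNormalDensity _).comp ω hd).fun_div (hsqrt.const_mul 2)
      (mul_ne_zero two_ne_zero hs)
    rw [heq.deriv_eq, hCω]
    refine h.deriv.trans ?_
    simp only [Function.comp]
    generalize stdNormalDensity (-k / √ω + √ω / 2) = p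
    generalize √ω = s at hs hsq
    subst hsq
    field_simp
    ring
  · have hfun : (fun k' => deriv (fun w' => Cdim w' k') ω) =
        fun k' => stdNormalDensity (-k' / √ω + √ω / 2) / (2 * √ω) :=
      funext fun k' => (hasDerivAt_Cdim_variance k' hω).deriv
    have hd := ((hasDerivAt_id k).fun_neg.div_const √ω).add_const (√ω / 2)
    have h := ((hasDerivAt_stdNormalDensity _).comp k hd).div_const (2 * √ω)
    rw [hfun, hCω]
    refine h.deriv.trans ?_
    simp only [id]
    generalize stdNormalDensity (-k / √ω + √ω / 2) = p
    generalize √ω = s at hs hsq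
    subst hsq
    field_simp
    ring
  · have hfun : (fun k' => deriv (fun k'' => Cdim ω k'') k') =
        fun k' => -(exp k' * Phi (-k' / √ω - √ω / 2)) :=
      funext fun k' => (hasDerivAt_Cdim_logMoneyness hω k').deriv
    have hd := ((hasDerivAt_id k).fun_neg.div_const √ω).sub_const (√ω / 2)
    have h := ((hasDerivAt_exp k).fun_mul ((hasDerivAt_Phi _).comp k hd)).fun_neg
    rw [hfun, hCω, (hasDerivAt_Cdim_logMoneyness hω k).deriv,
      ← exp_mul_stdNormalDensity k hs]
    rw [show deriv (fun k' => -(exp k' * Phi (-k' / √ω - √ω / 2))) k = _ from h.deriv]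
    simp only [id, Function.comp]
    field_simp
    ring
end

section
/- Let s₁, s₂, σ₁, σ₂, τ > 0 and ρ ∈ (−1, 1). Define σ² = σ₁² + σ₂² − 2ρσ₁σ₂, d₁ = (log(s₁/s₂) + σ²τ/2)/(σ√τ), and d₂ = d₁ − σ√τ. For independent standard normal variables Z₁, Z₂, set S¹ = s₁·exp(−σ₁²τ/2 + σ₁√τ·(√(1−ρ²)·Z₁ + ρ·Z₂)) and S² = s₂·exp(−σ₂²τ/2 + σ₂√τ·Z₂). Then E[max(S¹ − S², 0)] = s₁·Φ(d₁) − s₂·Φ(d₂) (the Margrabe formula for the exchange option with interest rate r = 0, expressed as a two-dimensional Gaussian integral). -/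
open Real MeasureTheory

open ProbabilityTheory

/-- The standard normal law gives the ray `(-∞, d)` mass `Phi d`. -/
lemma gaussianReal_real_Iio (d : ℝ) : (gaussianReal 0 1).real (Set.Iio d) = Phi d := by
  rw [Measure.real, gaussianReal_apply_eq_integral _ one_ne_zero, ENNReal.toReal_ofReal
    (integral_nonneg fun x => gaussianPDFReal_nonneg _ _ x), Phi, ← integral_const_mul]
  simp [gaussianPDFReal_def]

/-- An upper tail of a nondegenerate Gaussian law, in terms of `Phi`. -/
lemma gaussianReal_real_Ioi (m c : ℝ) {r : ℝ} (hr : 0 < r) {v : NNReal} (hv : (v : ℝ) = r ^ 2) :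
    (gaussianReal m v).real (Set.Ioi c) = Phi ((m - c) / r) := by
  have hmap : (gaussianReal 0 1).map (fun x => m + (-r) * x) = gaussianReal m v := by
    have h := (gaussianReal_const_add (gaussianReal_const_mul
      (HasLaw.id (μ := gaussianReal 0 1)) (-r)) m).map_eq
    have hv' : NNReal.mk ((-r) ^ 2) (sq_nonneg _) * 1 = v := by
      apply NNReal.eq
      simp [hv]
    rw [hv', mul_zero, zero_add] at h
    exact h
  rw [← hmap, map_measureReal_apply (by fun_prop) measurableSet_Ioi, ← gaussianReal_real_Iio]
  congr 1
  ext x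
  simp only [Set.mem_preimage, Set.mem_Ioi, Set.mem_Iio]
  rw [lt_div_iff₀ hr]
  constructor <;> intro h <;> linarith

/-- A linear form in two independent unit-variance Gaussian variables is Gaussian. -/
lemma gaussianReal_prod_map_linear (a b p q : ℝ) {v : NNReal} (hv : (v : ℝ) = p ^ 2 + q ^ 2) :
    ((gaussianReal a 1).prod (gaussianReal b 1)).map (fun z : ℝ × ℝ => p * z.1 + q * z.2)
      = gaussianReal (p * a + q * b) v := by
  have hind := indepFun_prod (μ := gaussianReal a 1) (ν := gaussianReal b 1)
    (X := fun x => p * x) (Y := fun x => q * x) (by fun_prop) (by fun_prop)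
  have hX := (gaussianReal_const_mul (P := (gaussianReal a 1).prod (gaussianReal b 1))
    (X := Prod.fst) (μ := a) (v := 1) ⟨by fun_prop, by simp [Measure.map_fst_prod]⟩ p).map_eq
  have hY := (gaussianReal_const_mul (P := (gaussianReal a 1).prod (gaussianReal b 1))
    (X := Prod.snd) (μ := b) (v := 1) ⟨by fun_prop, by simp [Measure.map_snd_prod]⟩ q).map_eq
  have h := gaussianReal_add_gaussianReal_of_indepFun hind hX hY
  have hv' : NNReal.mk (p ^ 2) (sq_nonneg _) * 1 + NNReal.mk (q ^ 2) (sq_nonneg _) * 1 = v := by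
    apply NNReal.eq
    simp [hv]
  rw [hv'] at h
  exact h

lemma integrable_gaussianPDFReal_prod (a b : ℝ) :
    Integrable (fun z : ℝ × ℝ => gaussianPDFReal a 1 z.1 * gaussianPDFReal b 1 z.2) :=
  (integrable_gaussianPDFReal a 1).mul_prod (integrable_gaussianPDFReal b 1)

lemma setIntegral_gaussianPDFReal_prod (a b : ℝ) {s : Set (ℝ × ℝ)} (hs : MeasurableSet s) :
    ∫ z in s, gaussianPDFReal a 1 z.1 * gaussianPDFReal b 1 z.2
      = ((gaussianReal a 1).prod (gaussianReal b 1)).real s := by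
  rw [gaussianReal_of_var_ne_zero _ one_ne_zero, gaussianReal_of_var_ne_zero _ one_ne_zero,
    prod_withDensity (measurable_gaussianPDF _ _) (measurable_gaussianPDF _ _), Measure.real,
    withDensity_apply _ hs, integral_eq_lintegral_of_nonneg_ae
      (ae_of_all _ fun z => mul_nonneg (gaussianPDFReal_nonneg _ _ _) (gaussianPDFReal_nonneg _ _ _))
      (integrable_gaussianPDFReal_prod a b).aestronglyMeasurable.restrict]
  simp only [gaussianPDF, ENNReal.ofReal_mul (gaussianPDFReal_nonneg _ _ _)]
  rfl

/-- The mass of an open half-plane under a unit-covariance Gaussian density. -/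
lemma setIntegral_halfPlane_gaussianPDFReal_prod (a b p q c : ℝ) {r : ℝ} (hr : 0 < r)
    (hpq : p ^ 2 + q ^ 2 = r ^ 2) :
    ∫ z in {z : ℝ × ℝ | c < p * z.1 + q * z.2}, gaussianPDFReal a 1 z.1 * gaussianPDFReal b 1 z.2
      = Phi ((p * a + q * b - c) / r) := by
  rw [setIntegral_gaussianPDFReal_prod _ _ (measurableSet_lt (by fun_prop) (by fun_prop)),
    ← gaussianReal_real_Ioi (p * a + q * b) c hr (v := ⟨r ^ 2, sq_nonneg r⟩) rfl,
    ← gaussianReal_prod_map_linear a b p q (v := ⟨r ^ 2, sq_nonneg r⟩) hpq.symm,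
    map_measureReal_apply (by fun_prop) measurableSet_Ioi]
  rfl

/-- An exponential tilt of the standard Gaussian density in the plane is a shifted one. -/
lemma exp_mul_gaussian_eq_gaussianPDFReal_prod (a b e x y : ℝ)
    (he : e = a * x + b * y - (a ^ 2 + b ^ 2) / 2) :
    Real.exp e * ((2 * Real.pi)⁻¹ * Real.exp (-(x ^ 2 + y ^ 2) / 2))
      = gaussianPDFReal a 1 x * gaussianPDFReal b 1 y := by
  have hpi : (2 * Real.pi)⁻¹ = (√(2 * Real.pi))⁻¹ * (√(2 * Real.pi))⁻¹ := by
    rw [← mul_inv, Real.mul_self_sqrt (by positivity)]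
  simp only [gaussianPDFReal_def, NNReal.coe_one, mul_one]
  rw [hpi, mul_mul_mul_comm, ← Real.exp_add, mul_left_comm, ← Real.exp_add, he]
  congr 2
  ring

/-- The Margrabe formula for the exchange option (interest rate `r = 0`), expressed as a
two-dimensional Gaussian integral: `E[max(S¹ − S², 0)] = s₁·Φ(d₁) − s₂·Φ(d₂)`. -/
theorem margrabe_formula
    (s₁ s₂ σ₁ σ₂ τ ρ : ℝ) (hs₁ : 0 < s₁) (hs₂ : 0 < s₂) (hσ₁ : 0 < σ₁) (hσ₂ : 0 < σ₂)
    (hτ : 0 < τ) (hρ : ρ ∈ Set.Ioo (-1 : ℝ) 1)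
    (σ d₁ d₂ : ℝ)
    (hσ : σ ^ 2 = σ₁ ^ 2 + σ₂ ^ 2 - 2 * ρ * σ₁ * σ₂) (hσpos : 0 < σ)
    (hd₁ : d₁ = (Real.log (s₁ / s₂) + σ ^ 2 * τ / 2) / (σ * Real.sqrt τ))
    (hd₂ : d₂ = d₁ - σ * Real.sqrt τ) :
    (∫ z : ℝ × ℝ,
        max (s₁ * Real.exp (-σ₁ ^ 2 * τ / 2 +
              σ₁ * Real.sqrt τ * (Real.sqrt (1 - ρ ^ 2) * z.1 + ρ * z.2)) -
            s₂ * Real.exp (-σ₂ ^ 2 * τ / 2 + σ₂ * Real.sqrt τ * z.2)) 0 *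
          ((2 * Real.pi)⁻¹ * Real.exp (-(z.1 ^ 2 + z.2 ^ 2) / 2)))
      = s₁ * Phi d₁ - s₂ * Phi d₂ := by
  obtain ⟨hρ₁, hρ₂⟩ := hρ
  obtain ⟨t, ht, rfl⟩ : ∃ t : ℝ, 0 < t ∧ τ = t ^ 2 :=
    ⟨√τ, Real.sqrt_pos.2 hτ, (Real.sq_sqrt hτ.le).symm⟩
  rw [Real.sqrt_sq ht.le] at *
  have hk : √(1 - ρ ^ 2) ^ 2 = 1 - ρ ^ 2 := Real.sq_sqrt (by nlinarith)
  set k := √(1 - ρ ^ 2)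
  set p := σ₁ * t * k with hp
  set q := σ₁ * t * ρ - σ₂ * t with hq
  set c := Real.log s₂ - Real.log s₁ + (σ₁ ^ 2 - σ₂ ^ 2) * t ^ 2 / 2 with hc
  have hr : 0 < σ * t := mul_pos hσpos ht
  have hpq : p ^ 2 + q ^ 2 = (σ * t) ^ 2 := by
    rw [hp, hq]
    linear_combination (σ₁ * t) ^ 2 * hk - t ^ 2 * hσ
  set G₁ : ℝ × ℝ → ℝ := fun z => gaussianPDFReal p 1 z.1 * gaussianPDFReal (σ₁ * t * ρ) 1 z.2
    with hG₁
  set G₂ : ℝ × ℝ → ℝ := fun z => gaussianPDFReal 0 1 z.1 * gaussianPDFReal (σ₂ * t) 1 z.2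
    with hG₂
  have hS : MeasurableSet {z : ℝ × ℝ | c < p * z.1 + q * z.2} :=
    measurableSet_lt (by fun_prop) (by fun_prop)
  have hlog : Real.log (s₁ / s₂) = Real.log s₁ - Real.log s₂ := Real.log_div hs₁.ne' hs₂.ne'
  have h₁ : ∫ z in {z : ℝ × ℝ | c < p * z.1 + q * z.2}, G₁ z = Phi d₁ := by
    rw [hG₁, setIntegral_halfPlane_gaussianPDFReal_prod _ _ _ _ _ hr hpq, hd₁, hlog]
    congr 2
    rw [hp, hq, hc]
    linear_combination (σ₁ * t) ^ 2 * hk - t ^ 2 / 2 * hσ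
  have h₂ : ∫ z in {z : ℝ × ℝ | c < p * z.1 + q * z.2}, G₂ z = Phi d₂ := by
    rw [hG₂, setIntegral_halfPlane_gaussianPDFReal_prod _ _ _ _ _ hr hpq, hd₂, hd₁, hlog]
    congr 1
    rw [div_sub' hr.ne']
    congr 1
    rw [hq, hc]
    linear_combination t ^ 2 / 2 * hσ
  have hpoint : ∀ z : ℝ × ℝ,
      max (s₁ * Real.exp (-σ₁ ^ 2 * t ^ 2 / 2 + σ₁ * t * (k * z.1 + ρ * z.2)) -
            s₂ * Real.exp (-σ₂ ^ 2 * t ^ 2 / 2 + σ₂ * t * z.2)) 0 *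
          ((2 * Real.pi)⁻¹ * Real.exp (-(z.1 ^ 2 + z.2 ^ 2) / 2))
        = {z : ℝ × ℝ | c < p * z.1 + q * z.2}.indicator (fun z => s₁ * G₁ z - s₂ * G₂ z) z := by
    intro z
    have hiff : s₂ * Real.exp (-σ₂ ^ 2 * t ^ 2 / 2 + σ₂ * t * z.2) <
        s₁ * Real.exp (-σ₁ ^ 2 * t ^ 2 / 2 + σ₁ * t * (k * z.1 + ρ * z.2)) ↔
        c < p * z.1 + q * z.2 := by
      rw [← Real.log_lt_log_iff (by positivity) (by positivity),
        Real.log_mul hs₂.ne' (Real.exp_pos _).ne', Real.log_mul hs₁.ne' (Real.exp_pos _).ne',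
        Real.log_exp, Real.log_exp, hp, hq, hc]
      constructor <;> intro h <;> linarith
    by_cases hz : c < p * z.1 + q * z.2
    · rw [Set.indicator_of_mem (by exact hz), max_eq_left (sub_nonneg.2 (hiff.2 hz).le), sub_mul,
        mul_assoc, mul_assoc s₂,
        exp_mul_gaussian_eq_gaussianPDFReal_prod p (σ₁ * t * ρ) _ z.1 z.2
          (by rw [hp]; linear_combination (σ₁ * t) ^ 2 / 2 * hk),
        exp_mul_gaussian_eq_gaussianPDFReal_prod 0 (σ₂ * t) _ z.1 z.2 (by ring)]
    · rw [Set.indicator_of_notMem (by exact hz),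
        max_eq_right (sub_nonpos.2 (not_lt.1 (mt hiff.1 hz))), zero_mul]
  simp_rw [hpoint]
  rw [integral_indicator hS, integral_sub
    ((integrable_gaussianPDFReal_prod _ _).restrict.const_mul s₁)
    ((integrable_gaussianPDFReal_prod _ _).restrict.const_mul s₂),
    integral_const_mul, integral_const_mul, h₁, h₂]
end

section
/- Let K > 0 and let u ∈ ℂ with Im(u) > 1. Then the Fourier transform of the call payoff converges absolutely and equals ∫_{−∞}^{∞} e^{ius} · max(e^s − K, 0) ds = −K^{1+iu}/(u² − iu), where K^{1+iu} = exp((1 + iu)·log K). -/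
open MeasureTheory Complex

/-- The integrand is `e^{(1+iu)s} − K e^{ius}` on `(log K, ∞)` and vanishes elsewhere. -/
lemma call_payoff_integrand_eq_indicator {K : ℝ} (hK : 0 < K) (u : ℂ) :
    (fun s : ℝ => Complex.exp (Complex.I * u * s) * (max (Real.exp s - K) 0 : ℝ)) =
      (Set.Ioi (Real.log K)).indicator (fun s : ℝ =>
        Complex.exp ((1 + Complex.I * u) * s) - K * Complex.exp (Complex.I * u * s)) := by
  ext s
  by_cases hs : Real.log K < s
  · have hexp : K < Real.exp s := (Real.log_lt_iff_lt_exp hK).mp hs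
    rw [Set.indicator_of_mem (Set.mem_Ioi.mpr hs), max_eq_left (sub_nonneg.mpr hexp.le),
      add_mul, Complex.exp_add]
    push_cast
    ring_nf
  · have hexp : Real.exp s ≤ K := (Real.le_log_iff_exp_le hK).mp (not_lt.mp hs)
    rw [Set.indicator_of_notMem (by simpa using hs), max_eq_right (sub_nonpos.mpr hexp)]
    simp

/-- The Fourier transform of the call payoff on the regularity strip `Im(u) > 1`:
the integral `∫ e^{ius}·max(e^s − K, 0) ds` converges absolutely and equals
`−K^{1+iu}/(u² − iu)`, where `K^{1+iu} = exp((1 + iu)·log K)`. -/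
theorem call_payoff_fourier_transform (K : ℝ) (hK : 0 < K) (u : ℂ) (hu : 1 < u.im) :
    Integrable (fun s : ℝ =>
      Complex.exp (Complex.I * u * s) * (max (Real.exp s - K) 0 : ℝ)) ∧
    (∫ s : ℝ, Complex.exp (Complex.I * u * s) * (max (Real.exp s - K) 0 : ℝ))
      = -Complex.exp ((1 + Complex.I * u) * Real.log K) / (u ^ 2 - Complex.I * u) := by
  have hb : (Complex.I * u).re < 0 := by
    simp only [Complex.I_mul_re]
    linarith
  have ha : (1 + Complex.I * u).re < 0 := by
    simp only [Complex.add_re, Complex.one_re, Complex.I_mul_re]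
    linarith
  have hia := integrableOn_exp_mul_complex_Ioi ha (Real.log K)
  have hib := (integrableOn_exp_mul_complex_Ioi hb (Real.log K)).const_mul (K : ℂ)
  rw [call_payoff_integrand_eq_indicator hK u]
  refine ⟨(integrable_indicator_iff measurableSet_Ioi).mpr (hia.sub hib), ?_⟩
  rw [integral_indicator measurableSet_Ioi, integral_sub hia hib, integral_const_mul,
    integral_exp_mul_complex_Ioi ha, integral_exp_mul_complex_Ioi hb]
  have hexp : Complex.exp ((1 + Complex.I * u) * Real.log K) =
      K * Complex.exp (Complex.I * u * Real.log K) := by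
    rw [add_mul, one_mul, Complex.exp_add, ← Complex.ofReal_exp, Real.exp_log hK]
  have ha0 : 1 + Complex.I * u ≠ 0 := fun h => by simp [h] at ha
  have hb0 : Complex.I * u ≠ 0 := fun h => by simp [h] at hb
  have hden : u ^ 2 - Complex.I * u = -((1 + Complex.I * u) * (Complex.I * u)) := by
    linear_combination u ^ 2 * Complex.I_sq
  rw [hden, hexp]
  generalize Complex.I * u = b at *
  field_simp
  ring
end
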